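/- arXiv:1812.09808 — 2 statements merged into one kernel-verified Lean document; each statement's English description precedes it below -/
import Mathlib

section
/- Consider the linear-quadratic Wasserstein-penalty setting with R symmetric positive definite and Q symmetric positive semidefinite. Let (λ_j) be a sequence of positive reals with λ_j → ∞, and for each j let P_j be a symmetric positive semidefinite n×n matrix with λ_j I − αΞᵀP_jΞ positive definite that solves the modified Riccati equation P_j = Q + αAᵀP_jA + α²AᵀS(λ_j, P_j)A, where S(λ,P) := PΞ(λI − αΞᵀPΞ)⁻¹ΞᵀP − [I + αΞ(λI − αΞᵀPΞ)⁻¹ΞᵀP]ᵀ P B [R + αBᵀ{P + αPΞ(λI − αΞᵀPΞ)⁻¹ΞᵀP}B]⁻¹ BᵀP [I + αΞ(λI − αΞᵀPΞ)⁻¹ΞᵀP]. Suppose P_j converges entrywise to a matrix P̄. Then P̄ is symmetric positive semidefinite and solves the discounted algebraic Riccati equation P̄ = Q + αAᵀP̄A − α²AᵀP̄B(R + αBᵀP̄B)⁻¹BᵀP̄A; moreover the feedback gains K(λ_j, P_j) := −[R + αBᵀ{P_j + αP_jΞ(λ_jI − αΞᵀP_jΞ)⁻¹ΞᵀP_j}B]⁻¹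 αBᵀP_jᵀ[I + αΞ(λ_jI − αΞᵀP_jΞ)⁻¹ΞᵀP_j]A converge to K̄ := −α(R + αBᵀP̄B)⁻¹BᵀP̄A, and for every x ∈ ℝⁿ and each i the worst-case atoms (λ_jI − αΞᵀP_jΞ)⁻¹[αΞᵀP_j(A + BK(λ_j,P_j))x + λ_j ŵ^(i)] converge to ŵ^(i). -/
open Matrix Filter

open scoped Topology in
/-- Inversion of real matrices is sequentially continuous at nonsingular matrices. -/
theorem Matrix.tendsto_inv_of_isUnit_det {ι κ : Type*} [Fintype κ] [DecidableEq κ] {f : Filter ι}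
    {M : ι → Matrix κ κ ℝ} {L : Matrix κ κ ℝ} (hM : Tendsto M f (𝓝 L)) (hL : IsUnit L.det) :
    Tendsto (fun j => (M j)⁻¹) f (𝓝 L⁻¹) := by
  simp only [Matrix.inv_def, Ring.inverse_eq_inv']
  have hdet : Tendsto (fun j => (M j).det) f (𝓝 L.det) :=
    ((continuous_id.matrix_det).tendsto L).comp hM
  have hadj : Tendsto (fun j => (M j).adjugate) f (𝓝 L.adjugate) :=
    ((continuous_id.matrix_adjugate).tendsto L).comp hM
  exact (hdet.inv₀ hL.ne_zero).smul hadj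

open scoped Topology in
/-- The entrywise limit of positive semidefinite real matrices is positive semidefinite. -/
theorem Matrix.posSemidef_of_tendsto {ι κ : Type*} [Fintype κ] {f : Filter ι} [f.NeBot]
    {M : ι → Matrix κ κ ℝ} {L : Matrix κ κ ℝ} (hM : Tendsto M f (𝓝 L))
    (hpsd : ∀ j, (M j).PosSemidef) : L.PosSemidef := by
  refine Matrix.PosSemidef.of_dotProduct_mulVec_nonneg ?_ fun x => ?_
  · have hT : Tendsto (fun j => (M j)ᴴ) f (𝓝 Lᴴ) :=
      ((continuous_id.matrix_conjTranspose).tendsto L).comp hM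
    exact tendsto_nhds_unique (hT.congr fun j => (hpsd j).isHermitian) hM
  · have hc : Continuous fun P : Matrix κ κ ℝ => star x ⬝ᵥ (P *ᵥ x) := by fun_prop
    exact ge_of_tendsto' ((hc.tendsto L).comp hM) fun j => (hpsd j).dotProduct_mulVec_nonneg x

/-- Proposition 6: convergence of the distributionally robust
linear-quadratic solution to the standard LQ solution as the penalty parameter tends to
`∞`: if `λ_j → ∞` and the Riccati solutions `P_j` converge entrywise to `P̄`, then `P̄`
is positive semidefinite and solves the discounted algebraic Riccati equation, the
feedback gains converge to the LQG gain `K̄ = −α(R + αBᵀP̄B)⁻¹BᵀP̄A`, and the worst-case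
atoms converge to the data samples `ŵ⁽ⁱ⁾`. -/
theorem lq_penalty_limit
    {n m l : ℕ}
    (A : Matrix (Fin n) (Fin n) ℝ) (B : Matrix (Fin n) (Fin m) ℝ)
    (Ξ : Matrix (Fin n) (Fin l) ℝ)
    (Q : Matrix (Fin n) (Fin n) ℝ) (hQ : Q.PosSemidef)
    (R : Matrix (Fin m) (Fin m) ℝ) (hR : R.PosDef)
    (α : ℝ) (hα0 : 0 < α) (hα1 : α < 1)
    (N : ℕ) (hN : 0 < N) (what : Fin N → (Fin l → ℝ))
    (lamseq : ℕ → ℝ) (hlampos : ∀ j, 0 < lamseq j)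
    (hlam : Tendsto lamseq atTop atTop)
    (Pseq : ℕ → Matrix (Fin n) (Fin n) ℝ)
    (hPpsd : ∀ j, (Pseq j).PosSemidef)
    (Gseq : ℕ → Matrix (Fin l) (Fin l) ℝ)
    (hGseq : ∀ j, Gseq j = lamseq j • (1 : Matrix (Fin l) (Fin l) ℝ)
        - α • (Ξᵀ * Pseq j * Ξ))
    (hGpd : ∀ j, (Gseq j).PosDef)
    (Sseq : ℕ → Matrix (Fin n) (Fin n) ℝ)
    (hSseq : ∀ j, Sseq j = Pseq j * Ξ * (Gseq j)⁻¹ * Ξᵀ * Pseq j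
      - ((1 : Matrix (Fin n) (Fin n) ℝ) + α • (Ξ * (Gseq j)⁻¹ * Ξᵀ * Pseq j))ᵀ * Pseq j * B
          * (R + α • (Bᵀ * (Pseq j + α • (Pseq j * Ξ * (Gseq j)⁻¹ * Ξᵀ * Pseq j)) * B))⁻¹
          * Bᵀ * Pseq j
          * ((1 : Matrix (Fin n) (Fin n) ℝ) + α • (Ξ * (Gseq j)⁻¹ * Ξᵀ * Pseq j)))
    (hRiccati : ∀ j, Pseq j = Q + α • (Aᵀ * Pseq j * A) + (α ^ 2) • (Aᵀ * Sseq j * A))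
    (Kseq : ℕ → Matrix (Fin m) (Fin n) ℝ)
    (hKseq : ∀ j, Kseq j
      = -((R + α • (Bᵀ * (Pseq j + α • (Pseq j * Ξ * (Gseq j)⁻¹ * Ξᵀ * Pseq j)) * B))⁻¹
          * (α • (Bᵀ * (Pseq j)ᵀ
              * ((1 : Matrix (Fin n) (Fin n) ℝ) + α • (Ξ * (Gseq j)⁻¹ * Ξᵀ * Pseq j)) * A))))
    (Pbar : Matrix (Fin n) (Fin n) ℝ)
    (hconv : ∀ a b, Tendsto (fun j => Pseq j a b) atTop (nhds (Pbar a b))) :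
    Pbar.PosSemidef
    ∧ Pbar = Q + α • (Aᵀ * Pbar * A)
        - (α ^ 2) • (Aᵀ * Pbar * B * (R + α • (Bᵀ * Pbar * B))⁻¹ * Bᵀ * Pbar * A)
    ∧ (∀ a b, Tendsto (fun j => Kseq j a b) atTop
        (nhds ((-(α • ((R + α • (Bᵀ * Pbar * B))⁻¹ * Bᵀ * Pbar * A))) a b)))
    ∧ ∀ (x : Fin n → ℝ) (i : Fin N),
        Tendsto (fun j => (Gseq j)⁻¹.mulVec
            (α • (Ξᵀ * Pseq j).mulVec ((A + B * Kseq j).mulVec x) + lamseq j • what i))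
          atTop (nhds (what i)) := by
  have hP : Tendsto Pseq atTop (nhds Pbar) :=
    tendsto_pi_nhds.2 fun a => tendsto_pi_nhds.2 fun b => hconv a b
  have hbar : Pbar.PosSemidef := Matrix.posSemidef_of_tendsto hP hPpsd
  have hbarT : Pbarᵀ = Pbar := by simpa using hbar.isHermitian.eq
  have hlinv : Tendsto (fun j => (lamseq j)⁻¹) atTop (nhds 0) := tendsto_inv_atTop_zero.comp hlam
  have hscaled : Tendsto (fun j => lamseq j • (Gseq j)⁻¹) atTop (nhds 1) := by
    have hc : Continuous fun p : ℝ × Matrix (Fin n) (Fin n) ℝ =>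
        (1 : Matrix (Fin l) (Fin l) ℝ) - p.1 • (α • (Ξᵀ * p.2 * Ξ)) := by fun_prop
    have h1 := (hc.tendsto (0, Pbar)).comp (hlinv.prodMk_nhds hP)
    simp only [zero_smul, sub_zero] at h1
    have h2 := Matrix.tendsto_inv_of_isUnit_det h1 (by simp)
    rw [inv_one] at h2
    refine h2.congr fun j => ?_
    have hne := (hlampos j).ne'
    have hG : (1 : Matrix (Fin l) (Fin l) ℝ) - (lamseq j)⁻¹ • (α • (Ξᵀ * Pseq j * Ξ))
        = (lamseq j)⁻¹ • Gseq j := by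
      rw [hGseq j, smul_sub, inv_smul_smul₀ hne]
    have hdet : IsUnit (Gseq j).det := (hGpd j).det_pos.ne'.isUnit
    simp only [Function.comp_apply, hG]
    apply Matrix.inv_eq_left_inv
    rw [Matrix.smul_mul, Matrix.mul_smul, Matrix.nonsing_inv_mul _ hdet, smul_smul,
      mul_inv_cancel₀ hne, one_smul]
  have hGinv : Tendsto (fun j => (Gseq j)⁻¹) atTop (nhds 0) := by
    have h := hlinv.smul hscaled
    rw [zero_smul] at h
    refine h.congr fun j => ?_
    rw [smul_smul, inv_mul_cancel₀ (hlampos j).ne', one_smul]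
  have hPG := hP.prodMk_nhds hGinv
  have hW : Tendsto (fun j => (R + α • (Bᵀ * (Pseq j
      + α • (Pseq j * Ξ * (Gseq j)⁻¹ * Ξᵀ * Pseq j)) * B))⁻¹) atTop
      (nhds (R + α • (Bᵀ * Pbar * B))⁻¹) := by
    have hc : Continuous fun p : Matrix (Fin n) (Fin n) ℝ × Matrix (Fin l) (Fin l) ℝ =>
        R + α • (Bᵀ * (p.1 + α • (p.1 * Ξ * p.2 * Ξᵀ * p.1)) * B) := by fun_prop
    have h := (hc.tendsto (Pbar, 0)).comp hPG
    simp only [Matrix.mul_zero, Matrix.zero_mul, smul_zero, add_zero] at h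
    refine Matrix.tendsto_inv_of_isUnit_det h ?_
    have hB : (Bᵀ * Pbar * B).PosSemidef := by
      simpa using hbar.conjTranspose_mul_mul_same B
    exact (hR.add_posSemidef (hB.smul hα0.le)).det_pos.ne'.isUnit
  have hall := hPG.prodMk_nhds hW
  have hK : Tendsto Kseq atTop
      (nhds (-(α • ((R + α • (Bᵀ * Pbar * B))⁻¹ * Bᵀ * Pbar * A)))) := by
    have hc : Continuous fun p : (Matrix (Fin n) (Fin n) ℝ × Matrix (Fin l) (Fin l) ℝ)
          × Matrix (Fin m) (Fin m) ℝ =>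
        -(p.2 * (α • (Bᵀ * p.1.1ᵀ
          * ((1 : Matrix (Fin n) (Fin n) ℝ) + α • (Ξ * p.1.2 * Ξᵀ * p.1.1)) * A))) := by fun_prop
    have h := (hc.tendsto _).comp hall
    simp only [Matrix.mul_zero, Matrix.zero_mul, smul_zero, add_zero, Matrix.mul_one, hbarT,
      Matrix.mul_smul] at h
    simp only [Matrix.mul_assoc] at h ⊢
    refine h.congr fun j => ?_
    rw [hKseq j]
    simp only [Function.comp_apply, Matrix.mul_assoc, Matrix.mul_smul]
  refine ⟨hbar, ?_, fun a b => ?_, fun x i => ?_⟩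
  · have hc : Continuous fun p : (Matrix (Fin n) (Fin n) ℝ × Matrix (Fin l) (Fin l) ℝ)
          × Matrix (Fin m) (Fin m) ℝ =>
        Q + α • (Aᵀ * p.1.1 * A) + (α ^ 2) • (Aᵀ * (p.1.1 * Ξ * p.1.2 * Ξᵀ * p.1.1
          - ((1 : Matrix (Fin n) (Fin n) ℝ) + α • (Ξ * p.1.2 * Ξᵀ * p.1.1))ᵀ * p.1.1 * B
            * p.2 * Bᵀ * p.1.1
            * ((1 : Matrix (Fin n) (Fin n) ℝ) + α • (Ξ * p.1.2 * Ξᵀ * p.1.1))) * A) := by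
      fun_prop
    have h := (hc.tendsto _).comp hall
    have hlim := tendsto_nhds_unique hP (h.congr fun j => by
      rw [Function.comp_apply, ← hSseq j]
      exact (hRiccati j).symm)
    simp only [Matrix.mul_zero, Matrix.zero_mul, smul_zero, add_zero, Matrix.mul_one,
      Matrix.transpose_one, Matrix.one_mul, zero_sub, Matrix.mul_neg, Matrix.neg_mul,
      smul_neg, ← sub_eq_add_neg] at hlim
    simpa only [Matrix.mul_assoc] using hlim
  · exact tendsto_pi_nhds.1 (tendsto_pi_nhds.1 hK a) b
  · have hc : Continuous fun p : ((Matrix (Fin n) (Fin n) ℝ × Matrix (Fin l) (Fin l) ℝ)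
          × Matrix (Fin m) (Fin n) ℝ) × Matrix (Fin l) (Fin l) ℝ =>
        p.1.1.2.mulVec (α • (Ξᵀ * p.1.1.1).mulVec ((A + B * p.1.2).mulVec x))
          + p.2.mulVec (what i) := by fun_prop
    have h := (hc.tendsto _).comp ((hPG.prodMk_nhds hK).prodMk_nhds hscaled)
    simp only [Matrix.zero_mulVec, Matrix.one_mulVec, zero_add] at h
    refine h.congr fun j => ?_
    simp only [Function.comp_apply, Matrix.mulVec_add, Matrix.mulVec_smul, Matrix.smul_mulVec]
end

section
/- Let W be a closed subset of ℝ^l equipped with a continuous metric d, p ∈ [1,∞), ŵ^(1),…,ŵ^(N) ∈ W, ν_N := (1/N) Σ_{i=1}^N δ_{ŵ^(i)}, and θ > 0. Fix x, and suppose that for each u ∈ U(x) the map w ↦ v(f(x,u,w)) is upper semicontinuous, ν_N-integrable, and satisfies sup_{w ∈ W}[α v(f(x,u,w)) − λ₀ d(w,ŵ^(i))^p] < ∞ for some λ₀ ≥ 0 and all i. Then the distributionally robust Bellman operator decomposes through the Wasserstein-penalty Bellman operators: (T v)(x) = inf_{λ ≥ 0} [ (T'_λ v)(x) + λ θ^p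 ], where (T'_λ v)(x) = inf_{u ∈ U(x)} [ c(x,u) + (1/N) Σ_{i=1}^N sup_{w' ∈ W} ( α v(f(x,u,w')) − λ d(ŵ^(i), w')^p ) ]. -/
open MeasureTheory ENNReal

/-- The order-`p` Wasserstein distance (as an extended nonnegative real) between two Borel
probability measures, defined as the infimum over couplings of the `p`-th root of the
transport cost. -/
noncomputable def Wdist {α : Type*} [MeasurableSpace α] (d : α → α → ℝ) (p : ℝ)
    (μ ν : Measure α) : ℝ≥0∞ :=
  ⨅ κ ∈ {κ : Measure (α × α) | IsProbabilityMeasure κ ∧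
      κ.map Prod.fst = μ ∧ κ.map Prod.snd = ν},
    (∫⁻ q, ENNReal.ofReal (d q.1 q.2 ^ p) ∂κ) ^ (1 / p)

/-- A scalar constraint that is strictly feasible admits a nonnegative Lagrange multiplier, as soon
as `M` bounds the value of all feasible two-point mixtures. -/
lemma exists_multiplier_of_mixture_bound {ι : Type*} (D G : ι → ℝ) (t M : ℝ)
    (hmix : ∀ a b : ℝ, ∀ i j, 0 ≤ a → 0 ≤ b → a + b = 1 →
      a * D i + b * D j ≤ t → a * G i + b * G j ≤ M)
    (hstrict : ∃ i, D i < t) :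
    ∃ lam : ℝ, 0 ≤ lam ∧ ∀ i, G i - lam * (D i - t) ≤ M := by
  have hsingle : ∀ i, D i ≤ t → G i ≤ M := fun i hi => by
    simpa using hmix 1 0 i i zero_le_one le_rfl (by simp) (by simpa using hi)
  set L : Set ℝ := insert 0 {r | ∃ i, t < D i ∧ r = (G i - M) / (D i - t)} with hL
  have hupper : ∀ j, D j < t → (M - G j) / (t - D j) ∈ upperBounds L := by
    rintro j hj r (rfl | ⟨i, hi, rfl⟩)
    · exact div_nonneg (sub_nonneg.2 (hsingle j hj.le)) (sub_pos.2 hj).le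
    · have h1 : 0 < D i - t := sub_pos.2 hi
      have h2 : 0 < t - D j := sub_pos.2 hj
      have h3 : 0 < D i - D j := by linarith
      rw [div_le_div_iff₀ h1 h2]
      have h := hmix ((t - D j) / (D i - D j)) ((D i - t) / (D i - D j)) i j (by positivity)
        (by positivity) (by field_simp; ring) (by apply le_of_eq; field_simp; ring)
      have h4 : (t - D j) / (D i - D j) * G i + (D i - t) / (D i - D j) * G j
          = ((t - D j) * G i + (D i - t) * G j) / (D i - D j) := by ring
      rw [h4, div_le_iff₀ h3] at h
      linarith
  obtain ⟨j₀, hj₀⟩ := hstrict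
  have hbdd : BddAbove L := ⟨_, hupper j₀ hj₀⟩
  have hne : L.Nonempty := ⟨0, Set.mem_insert _ _⟩
  refine ⟨sSup L, le_csSup hbdd (Set.mem_insert _ _), fun i => ?_⟩
  rcases lt_trichotomy (D i) t with hi | hi | hi
  · have h := csSup_le hne (hupper i hi)
    rw [le_div_iff₀ (sub_pos.2 hi)] at h
    linarith
  · have := hsingle i hi.le
    simpa [hi] using this
  · have h := le_csSup hbdd (Set.mem_insert_of_mem 0 ⟨i, hi, rfl⟩ : (G i - M) / (D i - t) ∈ L)
    rw [div_le_iff₀ (sub_pos.2 hi)] at h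
    linarith

lemma EReal.sum_ne_bot {ι : Type*} (s : Finset ι) (f : ι → EReal) (hf : ∀ i ∈ s, f i ≠ ⊥) :
    ∑ i ∈ s, f i ≠ ⊥ := by
  classical
  induction s using Finset.induction_on with
  | empty => simp
  | insert a s ha ih =>
    rw [Finset.sum_insert ha]
    exact EReal.add_ne_bot_iff.2 ⟨hf a (by simp), ih fun i hi => hf i (by simp [hi])⟩

lemma EReal.sum_eq_top {ι : Type*} (s : Finset ι) (f : ι → EReal) (hf : ∀ i ∈ s, f i ≠ ⊥)
    {i : ι} (hi : i ∈ s) (htop : f i = ⊤) : ∑ i ∈ s, f i = ⊤ := by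
  classical
  rw [← Finset.add_sum_erase s f hi, htop]
  exact EReal.top_add_of_ne_bot
    (EReal.sum_ne_bot _ _ fun j hj => hf j (Finset.mem_of_mem_erase hj))

lemma EReal.coe_sum {ι : Type*} (s : Finset ι) (f : ι → ℝ) :
    ((∑ i ∈ s, f i : ℝ) : EReal) = ∑ i ∈ s, (f i : EReal) := by
  classical
  induction s using Finset.induction_on with
  | empty => simp
  | insert a s ha ih => rw [Finset.sum_insert ha, Finset.sum_insert ha, EReal.coe_add, ih]

/-- A sum of suprema is bounded by any bound on the sums over all independent choices. -/
lemma EReal.sum_iSup_coe_le {ι Ω : Type*} [Fintype ι] [Nonempty Ω] (h : ι → Ω → ℝ) (B : ℝ)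
    (hB : ∀ w : ι → Ω, ∑ i, h i (w i) ≤ B) :
    ∑ i, ⨆ w, (h i w : EReal) ≤ (B : EReal) := by
  classical
  obtain ⟨w₀⟩ := ‹Nonempty Ω›
  have hbdd : ∀ i, BddAbove (Set.range (h i)) := by
    refine fun i => ⟨B - ∑ j ∈ Finset.univ.erase i, h j w₀, ?_⟩
    rintro _ ⟨w, rfl⟩
    have := hB (Function.update (fun _ => w₀) i w)
    rw [← Finset.add_sum_erase _ _ (Finset.mem_univ i), Finset.sum_congr rfl
      (g := fun j => h j w₀) (fun j hj => by rw [Function.update_of_ne (Finset.ne_of_mem_erase hj)]),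
      Function.update_self] at this
    linarith
  have hle : ∀ i, ⨆ w, (h i w : EReal) ≤ ((⨆ w, h i w : ℝ) : EReal) := fun i =>
    iSup_le fun w => EReal.coe_le_coe_iff.2 (le_ciSup (hbdd i) w)
  refine (Finset.sum_le_sum fun i _ => hle i).trans ?_
  rw [← EReal.coe_sum, EReal.coe_le_coe_iff]
  have : Nonempty Ω := ⟨w₀⟩
  refine le_of_forall_pos_le_add fun ε hε => ?_
  have hδ : 0 < ε / (Fintype.card ι + 1) := by positivity
  choose w hw using fun i => exists_lt_of_lt_ciSup (sub_lt_self (⨆ w, h i w) hδ)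
  have h1 : ∑ i, (⨆ w, h i w) ≤ ∑ i, (h i (w i) + ε / (Fintype.card ι + 1)) :=
    Finset.sum_le_sum fun i _ => by linarith [hw i]
  rw [Finset.sum_add_distrib, Finset.sum_const, Finset.card_univ, _root_.nsmul_eq_mul] at h1
  have h2 : (Fintype.card ι : ℝ) * (ε / (Fintype.card ι + 1)) ≤ ε := by
    rw [mul_div_assoc', div_le_iff₀ (by positivity)]
    nlinarith
  linarith [hB w]

/-- The empirical measure of a finite tuple of points. -/
noncomputable def empiricalMeasure {Ω : Type*} [MeasurableSpace Ω] {N : ℕ} (z : Fin N → Ω) :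
    Measure Ω :=
  (N : ℝ≥0∞)⁻¹ • ∑ i, Measure.dirac (z i)

namespace empiricalMeasure

variable {Ω Ω' : Type*} [MeasurableSpace Ω] [MeasurableSpace Ω'] {N : ℕ}

lemma isProbabilityMeasure (hN : 0 < N) (z : Fin N → Ω) :
    IsProbabilityMeasure (empiricalMeasure z) := by
  refine ⟨?_⟩
  simp only [empiricalMeasure, Measure.smul_apply, Measure.coe_finsetSum, Finset.sum_apply,
    measure_univ, Finset.sum_const, Finset.card_univ, Fintype.card_fin, smul_eq_mul, nsmul_eq_mul,
    mul_one]
  exact ENNReal.inv_mul_cancel (by simpa using hN.ne') (by simp)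

lemma map_eq {g : Ω → Ω'} (hg : Measurable g) (z : Fin N → Ω) :
    (empiricalMeasure z).map g = empiricalMeasure (g ∘ z) := by
  rw [empiricalMeasure, empiricalMeasure, Measure.map_smul, ← Measure.sum_fintype,
    Measure.map_sum hg.aemeasurable, Measure.sum_fintype]
  simp [Measure.map_dirac' hg]

variable [MeasurableSingletonClass Ω]

lemma integrable (z : Fin N → Ω) (g : Ω → ℝ) : Integrable g (empiricalMeasure z) := by
  rcases Nat.eq_zero_or_pos N with rfl | hN
  · simp [empiricalMeasure]
  · exact (integrable_finsetSum_measure.2 fun i _ => integrable_dirac (by simp)).smul_measure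
      (by simpa using hN.ne')

lemma integral_eq (z : Fin N → Ω) (g : Ω → ℝ) :
    ∫ w, g w ∂empiricalMeasure z = (1 / N : ℝ) * ∑ i, g (z i) := by
  rw [empiricalMeasure, integral_smul_measure,
    integral_finsetSum_measure fun i _ => integrable_dirac (by simp)]
  simp

lemma ae_mem_range (z : Fin N → Ω) : ∀ᵐ w ∂empiricalMeasure z, w ∈ Set.range z := by
  refine Measure.ae_smul_measure ?_ _
  rw [← Measure.sum_fintype, Measure.ae_sum_iff]
  exact fun i => (ae_dirac_eq (z i)).symm ▸ ⟨i, rfl⟩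

end empiricalMeasure

section Duality

variable {Ω : Type*} [MeasurableSpace Ω] {d : Ω → Ω → ℝ} {p θ : ℝ} {N : ℕ}

/-- Two-point mixtures of perturbed samples lie in the Wasserstein ball around the empirical
measure when their transport cost does. -/
lemma Wdist_mixture_le [MeasurableSingletonClass Ω]
    (hd_nonneg : ∀ w w', 0 ≤ d w w') (hd_symm : ∀ w w', d w w' = d w' w)
    (hp : 1 ≤ p) (hN : 0 < N) (what z z' : Fin N → Ω) (hθ : 0 < θ) {a b : ℝ}
    (ha : 0 ≤ a) (hb : 0 ≤ b) (hab : a + b = 1)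
    (hcost : a * ((1 / N : ℝ) * ∑ i, d (what i) (z i) ^ p)
      + b * ((1 / N : ℝ) * ∑ i, d (what i) (z' i) ^ p) ≤ θ ^ p) :
    Wdist d p (ENNReal.ofReal a • empiricalMeasure z + ENNReal.ofReal b • empiricalMeasure z')
      (empiricalMeasure what) ≤ ENNReal.ofReal θ := by
  have hab' : ENNReal.ofReal a + ENNReal.ofReal b = 1 := by
    rw [← ENNReal.ofReal_add ha hb, hab, ENNReal.ofReal_one]
  have hp0 : 0 < p := by linarith
  set κ : Measure (Ω × Ω) := ENNReal.ofReal a • empiricalMeasure (fun i => (z i, what i))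
    + ENNReal.ofReal b • empiricalMeasure (fun i => (z' i, what i)) with hκ
  have hκmem : κ ∈ {κ : Measure (Ω × Ω) | IsProbabilityMeasure κ ∧
      κ.map Prod.fst = ENNReal.ofReal a • empiricalMeasure z
        + ENNReal.ofReal b • empiricalMeasure z' ∧
      κ.map Prod.snd = empiricalMeasure what} := by
    refine ⟨⟨?_⟩, ?_, ?_⟩
    · have h1 := empiricalMeasure.isProbabilityMeasure hN (fun i => (z i, what i))
      have h2 := empiricalMeasure.isProbabilityMeasure hN (fun i => (z' i, what i))
      simp [hκ, hab']
    · rw [hκ, Measure.map_add _ _ measurable_fst, Measure.map_smul, Measure.map_smul,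
        empiricalMeasure.map_eq measurable_fst, empiricalMeasure.map_eq measurable_fst]
      rfl
    · rw [hκ, Measure.map_add _ _ measurable_snd, Measure.map_smul, Measure.map_smul,
        empiricalMeasure.map_eq measurable_snd, empiricalMeasure.map_eq measurable_snd]
      simp only [Function.comp_def]
      rw [← add_smul, hab', one_smul]
  have hint : Integrable (fun q : Ω × Ω => d q.1 q.2 ^ p) κ :=
    ((empiricalMeasure.integrable _ _).smul_measure ENNReal.ofReal_ne_top).add_measure
      ((empiricalMeasure.integrable _ _).smul_measure ENNReal.ofReal_ne_top)
  have hnn : ∀ q : Ω × Ω, 0 ≤ d q.1 q.2 ^ p := fun q => Real.rpow_nonneg (hd_nonneg _ _) _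
  refine (iInf₂_le κ hκmem).trans ?_
  rw [← ofReal_integral_eq_lintegral_ofReal hint (Filter.Eventually.of_forall hnn), hκ,
    integral_add_measure
      ((empiricalMeasure.integrable _ _).smul_measure ENNReal.ofReal_ne_top)
      ((empiricalMeasure.integrable _ _).smul_measure ENNReal.ofReal_ne_top),
    integral_smul_measure, integral_smul_measure, empiricalMeasure.integral_eq,
    empiricalMeasure.integral_eq, ENNReal.toReal_ofReal ha, ENNReal.toReal_ofReal hb]
  simp only [smul_eq_mul, fun i => hd_symm (z i) (what i), fun i => hd_symm (z' i) (what i)]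
  calc _ ≤ (ENNReal.ofReal (θ ^ p)) ^ (1 / p) :=
        ENNReal.rpow_le_rpow (ENNReal.ofReal_le_ofReal hcost) (by positivity)
    _ = ENNReal.ofReal θ := by
        rw [← ENNReal.ofReal_rpow_of_pos hθ, ← ENNReal.rpow_mul, mul_one_div_cancel hp0.ne',
          ENNReal.rpow_one]

/-- Weak duality between the Wasserstein-ball problem and its penalized form. -/
lemma integral_le_penalty [MeasurableSingletonClass Ω]
    (hd_meas : Measurable fun q : Ω × Ω => d q.1 q.2)
    (hd_nonneg : ∀ w w', 0 ≤ d w w') (hd_symm : ∀ w w', d w w' = d w' w)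
    (hp : 1 ≤ p) (what : Fin N → Ω) (hθ : 0 < θ) {μ : Measure Ω} {g : Ω → ℝ}
    (hg : Integrable g μ) (hW : Wdist d p μ (empiricalMeasure what) ≤ ENNReal.ofReal θ)
    {lam : ℝ} (hlam : 0 ≤ lam) (s : Ω → ℝ)
    (hs : ∀ i w, g w - lam * d (what i) w ^ p ≤ s (what i)) :
    ∫ w, g w ∂μ ≤ (1 / N : ℝ) * ∑ i, s (what i) + lam * θ ^ p := by
  have hp0 : 0 < p := by linarith
  have key : ∀ τ, θ < τ → ∫ w, g w ∂μ ≤ (1 / N : ℝ) * ∑ i, s (what i) + lam * τ ^ p := by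
    intro τ hτ
    have hτ0 : 0 < τ := hθ.trans hτ
    have hlt := hW.trans_lt ((ENNReal.ofReal_lt_ofReal_iff hτ0).2 hτ)
    simp only [Wdist, iInf_lt_iff] at hlt
    obtain ⟨κ, ⟨-, rfl, hsnd⟩, hκ⟩ := hlt
    have hcost : ∫⁻ q, ENNReal.ofReal (d q.1 q.2 ^ p) ∂κ ≤ ENNReal.ofReal (τ ^ p) := by
      rw [← ENNReal.ofReal_rpow_of_pos hτ0]
      exact (ENNReal.rpow_inv_le_iff hp0).1 (by simpa using hκ.le)
    have hnn : ∀ q : Ω × Ω, 0 ≤ d q.1 q.2 ^ p := fun q => Real.rpow_nonneg (hd_nonneg _ _) _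
    have hmeas : Measurable fun q : Ω × Ω => d q.1 q.2 ^ p := hd_meas.pow_const p
    have hdint : Integrable (fun q : Ω × Ω => d q.1 q.2 ^ p) κ := by
      refine ⟨hmeas.aestronglyMeasurable, ?_⟩
      rw [hasFiniteIntegral_iff_ofReal (Filter.Eventually.of_forall hnn)]
      exact hcost.trans_lt ENNReal.ofReal_lt_top
    have hdle : ∫ q, d q.1 q.2 ^ p ∂κ ≤ τ ^ p := by
      rw [integral_eq_lintegral_of_nonneg_ae (Filter.Eventually.of_forall hnn)
        hmeas.aestronglyMeasurable]
      exact ENNReal.toReal_le_of_le_ofReal (by positivity) hcost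
    have hsint : Integrable s (κ.map Prod.snd) := hsnd ▸ empiricalMeasure.integrable what s
    have hae : ∀ᵐ q ∂κ, q.2 ∈ Set.range what :=
      ae_of_ae_map measurable_snd.aemeasurable (hsnd ▸ empiricalMeasure.ae_mem_range what)
    calc ∫ w, g w ∂κ.map Prod.fst = ∫ q, g q.1 ∂κ :=
          integral_map measurable_fst.aemeasurable hg.aestronglyMeasurable
      _ ≤ ∫ q, (s q.2 + lam * d q.1 q.2 ^ p) ∂κ := by
          refine integral_mono_ae (hg.comp_measurable measurable_fst)
            ((hsint.comp_measurable measurable_snd).add (hdint.const_mul lam)) ?_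
          filter_upwards [hae] with q hq
          obtain ⟨i, hi⟩ := hq
          have := hs i q.1
          rw [hi, hd_symm] at this
          linarith
      _ = ∫ q, s q.2 ∂κ + lam * ∫ q, d q.1 q.2 ^ p ∂κ := by
          rw [← integral_const_mul]
          exact integral_add (hsint.comp_measurable measurable_snd) (hdint.const_mul lam)
      _ = (1 / N : ℝ) * ∑ i, s (what i) + lam * ∫ q, d q.1 q.2 ^ p ∂κ := by
          rw [← integral_map measurable_snd.aemeasurable hsint.aestronglyMeasurable, hsnd,
            empiricalMeasure.integral_eq]
      _ ≤ _ := by gcongr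
  have hcont : Filter.Tendsto (fun τ : ℝ => (1 / N : ℝ) * ∑ i, s (what i) + lam * τ ^ p)
      (nhdsWithin θ (Set.Ioi θ)) (nhds ((1 / N : ℝ) * ∑ i, s (what i) + lam * θ ^ p)) :=
    ((((Real.continuousAt_rpow_const θ p (Or.inl hθ.ne')).tendsto.const_mul lam).const_add
      _).mono_left nhdsWithin_le_nhds)
  exact ge_of_tendsto hcont (by filter_upwards [self_mem_nhdsWithin] with τ hτ using key τ hτ)

/-- Strong duality: a real bound on the Wasserstein-ball problem bounds some penalized problem. -/
lemma exists_penalty_le [MeasurableSingletonClass Ω]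
    (hd_nonneg : ∀ w w', 0 ≤ d w w') (hd_self : ∀ w, d w w = 0)
    (hd_symm : ∀ w w', d w w' = d w' w)
    (hp : 1 ≤ p) (hN : 0 < N) (what : Fin N → Ω) (hθ : 0 < θ) (g : Ω → ℝ) (M : ℝ)
    (hM : ∀ μ : Measure Ω, IsProbabilityMeasure μ → Integrable g μ →
      Wdist d p μ (empiricalMeasure what) ≤ ENNReal.ofReal θ → ∫ w, g w ∂μ ≤ M) :
    ∃ lam : ℝ, 0 ≤ lam ∧
      ((1 / N : ℝ) : EReal) * ∑ i, ⨆ w, ((g w - lam * d (what i) w ^ p : ℝ) : EReal)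
        ≤ ((M - lam * θ ^ p : ℝ) : EReal) := by
  have hN' : (0 : ℝ) < N := by exact_mod_cast hN
  have : Nonempty Ω := ⟨what ⟨0, hN⟩⟩
  obtain ⟨lam, hlam, h⟩ := exists_multiplier_of_mixture_bound
    (fun z : Fin N → Ω => (1 / N : ℝ) * ∑ i, d (what i) (z i) ^ p)
    (fun z => (1 / N : ℝ) * ∑ i, g (z i)) (θ ^ p) M
    (by
      intro a b z z' ha hb hab hcost
      have h1 := empiricalMeasure.isProbabilityMeasure hN z
      have h2 := empiricalMeasure.isProbabilityMeasure hN z'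
      have i1 := (empiricalMeasure.integrable z g).smul_measure
        (ENNReal.ofReal_ne_top (r := a))
      have i2 := (empiricalMeasure.integrable z' g).smul_measure
        (ENNReal.ofReal_ne_top (r := b))
      have := hM _ ⟨by simp [← ENNReal.ofReal_add ha hb, hab]⟩ (i1.add_measure i2)
        (Wdist_mixture_le hd_nonneg hd_symm hp hN what z z' hθ ha hb hab hcost)
      rwa [integral_add_measure i1 i2, integral_smul_measure, integral_smul_measure,
        empiricalMeasure.integral_eq, empiricalMeasure.integral_eq, ENNReal.toReal_ofReal ha,
        ENNReal.toReal_ofReal hb] at this)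
    ⟨what, by
      simp only [hd_self, Real.zero_rpow (by linarith : p ≠ 0), Finset.sum_const_zero, mul_zero]
      positivity⟩
  refine ⟨lam, hlam, ?_⟩
  have hsum := EReal.sum_iSup_coe_le (fun i w => g w - lam * d (what i) w ^ p)
    (N * (M - lam * θ ^ p)) (fun z => by
      have hz := h z
      rw [Finset.sum_sub_distrib, ← Finset.mul_sum]
      have : (∑ i, g (z i)) - lam * ∑ i, d (what i) (z i) ^ p
          = N * ((1 / N : ℝ) * ∑ i, g (z i) - lam * ((1 / N : ℝ) * ∑ i, d (what i) (z i) ^ p)) := by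
        field_simp
      rw [this]
      exact mul_le_mul_of_nonneg_left (by linarith) hN'.le)
  refine (mul_le_mul_of_nonneg_left hsum (EReal.coe_nonneg.2 (by positivity))).trans ?_
  rw [← EReal.coe_mul, EReal.coe_le_coe_iff]
  apply le_of_eq
  field_simp

end Duality

/-- Proposition 5: the distributionally robust Bellman operator
decomposes through the Wasserstein-penalty Bellman operators:
`(T v)(x) = inf_{λ ≥ 0} [ (T'_λ v)(x) + λ θ^p ]`, where
`(T'_λ v)(x) = inf_{u ∈ U(x)} [ c(x,u) + (1/N) ∑ᵢ sup_{w'} (α v(f(x,u,w')) − λ d(ŵ⁽ⁱ⁾, w')^p) ]`. -/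
theorem bellman_penalty_decomposition
    {n m l : ℕ} (Xs : Set (Fin n → ℝ)) (Us : Set (Fin m → ℝ)) (W : Set (Fin l → ℝ))
    (hWclosed : IsClosed W)
    (d : ↥W → ↥W → ℝ)
    (hd_cont : Continuous fun q : ↥W × ↥W => d q.1 q.2)
    (hd_nonneg : ∀ w w', 0 ≤ d w w')
    (hd_eq_zero : ∀ w w', d w w' = 0 ↔ w = w')
    (hd_symm : ∀ w w', d w w' = d w' w)
    (hd_triangle : ∀ w w' w'', d w w'' ≤ d w w' + d w' w'')
    (p : ℝ) (hp : 1 ≤ p)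
    (N : ℕ) (hN : 0 < N) (what : Fin N → ↥W)
    (ν : Measure ↥W) (hν : ν = ((N : ℝ≥0∞))⁻¹ • ∑ i, Measure.dirac (what i))
    (θ : ℝ) (hθ : 0 < θ)
    (f : ↥Xs → ↥Us → ↥W → ↥Xs) (c : ↥Xs → ↥Us → ℝ)
    (α : ℝ) (hα0 : 0 < α) (hα1 : α < 1)
    (Uadm : ↥Xs → Set ↥Us)
    (v : ↥Xs → ℝ) (x : ↥Xs) (hUne : (Uadm x).Nonempty)
    (husc : ∀ u ∈ Uadm x, UpperSemicontinuous fun w : ↥W => v (f x u w))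
    (hint : ∀ u ∈ Uadm x, Integrable (fun w => v (f x u w)) ν)
    (hfin : ∀ u ∈ Uadm x, ∃ lam0 : ℝ, 0 ≤ lam0 ∧ ∀ i, BddAbove
      (Set.range fun w : ↥W => α * v (f x u w) - lam0 * d (what i) w ^ p)) :
    (⨅ u : Uadm x,
        ⨆ μ : {μ : Measure ↥W // IsProbabilityMeasure μ ∧
            Integrable (fun w => v (f x u.1 w)) μ ∧ Wdist d p μ ν ≤ ENNReal.ofReal θ},
          ((c x u.1 + α * ∫ w, v (f x u.1 w) ∂μ.1 : ℝ) : EReal))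
      = ⨅ lam : {t : ℝ // 0 ≤ t},
          (⨅ u : Uadm x,
            ((c x u.1 : ℝ) : EReal)
              + ((1 / N : ℝ) : EReal)
                * ∑ i, ⨆ w' : ↥W,
                    ((α * v (f x u.1 w') - lam.1 * d (what i) w' ^ p : ℝ) : EReal))
          + ((lam.1 * θ ^ p : ℝ) : EReal) := by
  have hν' : ν = empiricalMeasure what := hν
  subst hν'
  have : Nonempty ↥W := ⟨what ⟨0, hN⟩⟩
  have hNpos : (0 : ℝ) < 1 / N := by
    have : (0 : ℝ) < N := by exact_mod_cast hN
    positivity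
  apply le_antisymm
  · refine le_iInf fun lam => ?_
    rw [← EReal.sub_le_iff_le_add (Or.inl (EReal.coe_ne_bot _)) (Or.inl (EReal.coe_ne_top _))]
    refine le_iInf fun u => ?_
    rw [EReal.sub_le_iff_le_add (Or.inl (EReal.coe_ne_bot _)) (Or.inl (EReal.coe_ne_top _))]
    refine (iInf_le _ u).trans (iSup_le fun μ => ?_)
    set S : ↥W → EReal := fun y =>
      ⨆ w' : ↥W, ((α * v (f x u.1 w') - lam.1 * d y w' ^ p : ℝ) : EReal) with hS
    have hbot : ∀ y, S y ≠ ⊥ := fun y =>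
      ((EReal.bot_lt_coe _).trans_le (le_iSup (fun w' : ↥W =>
        ((α * v (f x u.1 w') - lam.1 * d y w' ^ p : ℝ) : EReal)) y)).ne'
    by_cases htop : ∃ i, S (what i) = ⊤
    · obtain ⟨i, hi⟩ := htop
      have : ∑ i, S (what i) = ⊤ :=
        EReal.sum_eq_top _ _ (fun i _ => hbot _) (Finset.mem_univ i) hi
      rw [this, EReal.coe_mul_top_of_pos hNpos, EReal.coe_add_top, EReal.top_add_coe]
      exact le_top
    · push Not at htop
      have hcoe : ∀ i, ((S (what i)).toReal : EReal) = S (what i) := fun i =>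
        EReal.coe_toReal (htop i) (hbot _)
      have h := integral_le_penalty hd_cont.measurable hd_nonneg hd_symm hp what hθ
        (μ.2.2.1.const_mul α) μ.2.2.2 lam.2 (fun y => (S y).toReal) (fun i w => by
          rw [← EReal.coe_le_coe_iff, hcoe]
          exact le_iSup (fun w' : ↥W =>
            ((α * v (f x u.1 w') - lam.1 * d (what i) w' ^ p : ℝ) : EReal)) w)
      rw [integral_const_mul] at h
      rw [Finset.sum_congr rfl fun i _ => (hcoe i).symm, ← EReal.coe_sum, ← EReal.coe_mul,
        ← EReal.coe_add, ← EReal.coe_add, EReal.coe_le_coe_iff]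
      linarith
  · refine le_iInf fun u => ?_
    set P : EReal := ⨆ μ : {μ : Measure ↥W // IsProbabilityMeasure μ ∧
      Integrable (fun w => v (f x u.1 w)) μ ∧
        Wdist d p μ (empiricalMeasure what) ≤ ENNReal.ofReal θ},
      ((c x u.1 + α * ∫ w, v (f x u.1 w) ∂μ.1 : ℝ) : EReal) with hP
    by_cases hPtop : P = ⊤
    · rw [hPtop]
      exact le_top
    have hle : ∀ μ : Measure ↥W, IsProbabilityMeasure μ →
        Integrable (fun w => α * v (f x u.1 w)) μ →
        Wdist d p μ (empiricalMeasure what) ≤ ENNReal.ofReal θ →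
        ((c x u.1 + ∫ w, α * v (f x u.1 w) ∂μ : ℝ) : EReal) ≤ P := by
      intro μ h1 h2 h3
      rw [integral_const_mul]
      exact le_iSup (fun μ : {μ : Measure ↥W // IsProbabilityMeasure μ ∧
        Integrable (fun w => v (f x u.1 w)) μ ∧
          Wdist d p μ (empiricalMeasure what) ≤ ENNReal.ofReal θ} =>
        ((c x u.1 + α * ∫ w, v (f x u.1 w) ∂μ.1 : ℝ) : EReal))
        ⟨μ, h1, (integrable_const_mul_iff (isUnit_iff_ne_zero.2 hα0.ne') _).1 h2, h3⟩
    have hd_self : ∀ w, d w w = 0 := fun w => (hd_eq_zero w w).2 rfl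
    obtain ⟨lam, hlam, h⟩ := exists_penalty_le hd_nonneg hd_self hd_symm hp hN what hθ
      (fun w => α * v (f x u.1 w)) (P.toReal - c x u.1) (fun μ h1 h2 h3 => by
        have := hle μ h1 h2 h3
        have := EReal.coe_le_coe_iff.1 (this.trans (EReal.le_coe_toReal hPtop))
        linarith)
    have hPbot : P ≠ ⊥ := by
      have hself : Wdist d p (empiricalMeasure what) (empiricalMeasure what)
          ≤ ENNReal.ofReal θ := by
        have := Wdist_mixture_le hd_nonneg hd_symm hp hN what what what hθ zero_le_one le_rfl
          (add_zero 1) (by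
            simp only [hd_self, Real.zero_rpow (by linarith : p ≠ 0), Finset.sum_const_zero,
              mul_zero, add_zero]
            positivity)
        simpa using this
      exact ((EReal.bot_lt_coe _).trans_le (hle _ (empiricalMeasure.isProbabilityMeasure hN what)
        (empiricalMeasure.integrable _ _) hself)).ne'
    refine (iInf_le _ ⟨lam, hlam⟩).trans ?_
    refine (add_le_add_left ((iInf_le _ u).trans (add_le_add_right h _)) _).trans ?_
    rw [← EReal.coe_add, ← EReal.coe_add]
    refine le_of_eq_of_le ?_ (EReal.coe_toReal hPtop hPbot).le
    congr 1
    ring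
end
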